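/- Let α ∈ ℝ \ {0} and let m, n ∈ ℤ satisfy q^m < |α| and q^n < |α|. Then the third Jackson q-Bessel functions satisfy the orthogonality relation ∑_{j=−∞}^{∞} J_{j+m}(α^{−1} q^{m}; q) · J_{j+n}(α^{−1} q^{n}; q) = δ_{m,n} / (1 − α^{−2} q^{2m}). -/

import Mathlib

open Complex Filter Topology

/-- Finite q-Pochhammer symbol `(a;q)_n`. -/
noncomputable def qp (q a : ℂ) (n : ℕ) : ℂ := ∏ k ∈ Finset.range n, (1 - a * q ^ k)

/-- Infinite q-Pochhammer symbol `(a;q)_∞`. -/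
noncomputable def qpInf (q a : ℂ) : ℂ := ∏' k : ℕ, (1 - a * q ^ k)

/-- Regularized confluent basic hypergeometric series `₁φ̃₁(0;b;q,w)`. -/
noncomputable def phiT (q b w : ℂ) : ℂ :=
  ∑' k : ℕ, qpInf q (b * q ^ k) * (-1) ^ k * q ^ (k * (k - 1) / 2) * w ^ k / qp q q k

/-- The eigenvector components `v_{m,j}`. -/
noncomputable def vmj (q α : ℝ) (m j : ℤ) : ℂ :=
  (-1) ^ j * (α : ℂ) ^ (-j) * (q : ℂ) ^ (j * (j + 1) / 2) *
    phiT (q : ℂ) ((q : ℂ) ^ (j - m + 1)) ((α : ℂ) ^ (-2 : ℤ) * (q : ℂ) ^ (m + j + 1))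

/-- The third Jackson q-Bessel function of integer order `n`:
`J_n(z;q) = (z^n/(q;q)_∞) ₁φ̃₁(0;q^{n+1};q,qz²)`. -/
noncomputable def qBesselJ (q : ℝ) (n : ℤ) (z : ℂ) : ℂ :=
  z ^ n / qpInf (q : ℂ) (q : ℂ) * phiT (q : ℂ) ((q : ℂ) ^ (n + 1)) ((q : ℂ) * z ^ 2)

/-- The coefficients of `1 / (t;q)_∞` as a power series in `t`. -/
noncomputable def qExpCoeff (q : ℂ) (n : ℕ) : ℂ := (qp q q n)⁻¹

/-- The coefficients of `(q t;q)_∞` as a power series in `t`. -/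
noncomputable def qExpInvCoeff (q : ℂ) (n : ℕ) : ℂ :=
  (-1) ^ n * q ^ (n * (n + 1) / 2) * (qp q q n)⁻¹

/-- The extension by zero of `qExpCoeff` to the integers. -/
noncomputable def qExpCoeffInt (q : ℂ) (k : ℤ) : ℂ := if 0 ≤ k then qExpCoeff q k.toNat else 0

@[simp]
lemma qExpCoeffInt_natCast (q : ℂ) (n : ℕ) : qExpCoeffInt q n = qExpCoeff q n := by
  simp [qExpCoeffInt]

lemma qExpCoeffInt_of_neg (q : ℂ) {k : ℤ} (hk : k < 0) : qExpCoeffInt q k = 0 := by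
  simp [qExpCoeffInt, hk]

section QPochhammer

variable {q : ℂ}

lemma one_sub_pow_succ_ne_zero (hq : ‖q‖ < 1) (n : ℕ) : 1 - q ^ (n + 1) ≠ 0 := by
  intro h
  have h1 : ‖q ^ (n + 1)‖ < 1 := by
    rw [norm_pow]
    exact pow_lt_one₀ (norm_nonneg _) hq n.succ_ne_zero
  rw [← sub_eq_zero.mp h] at h1
  simp at h1

lemma qp_self_succ (q : ℂ) (n : ℕ) : qp q q (n + 1) = qp q q n * (1 - q ^ (n + 1)) := by
  rw [qp, Finset.prod_range_succ, ← qp, pow_succ']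

lemma qp_self_ne_zero (hq : ‖q‖ < 1) (n : ℕ) : qp q q n ≠ 0 := by
  rw [qp, Finset.prod_ne_zero_iff]
  intro k _
  rw [← pow_succ']
  exact one_sub_pow_succ_ne_zero hq k

lemma summable_norm_neg_mul_pow (hq : ‖q‖ < 1) (a : ℂ) : Summable fun k : ℕ => ‖-(a * q ^ k)‖ := by
  simpa only [norm_neg, norm_mul, norm_pow] using
    (summable_geometric_of_lt_one (norm_nonneg q) hq).mul_left ‖a‖

lemma multipliable_one_sub_mul_pow (hq : ‖q‖ < 1) (a : ℂ) :
    Multipliable fun k : ℕ => 1 - a * q ^ k := by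
  simpa only [sub_eq_add_neg] using
    multipliable_one_add_of_summable (summable_norm_neg_mul_pow hq a)

lemma qpInf_self_ne_zero (hq : ‖q‖ < 1) : qpInf q q ≠ 0 := by
  simp only [qpInf, sub_eq_add_neg]
  refine tprod_one_add_ne_zero_of_summable (fun k => ?_) (summable_norm_neg_mul_pow hq q)
  rw [← sub_eq_add_neg, ← pow_succ']
  exact one_sub_pow_succ_ne_zero hq k

lemma qp_mul_qpInf (hq : ‖q‖ < 1) (a : ℂ) (n : ℕ) :
    qp q a n * qpInf q (a * q ^ n) = qpInf q a := by
  have h : (fun k : ℕ => 1 - a * q ^ n * q ^ k) = fun k => 1 - a * q ^ (k + n) := by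
    ext k
    ring
  have hm := multipliable_one_sub_mul_pow hq (a * q ^ n)
  rw [qp, qpInf, qpInf, h]
  rw [h] at hm
  exact hm.prod_mul_tprod_nat_mul' (f := fun k => 1 - a * q ^ k)

lemma qpInf_eq_zero (hq0 : q ≠ 0) {k : ℤ} (hk : k ≤ 0) : qpInf q (q ^ k) = 0 := by
  refine tprod_of_exists_eq_zero ⟨k.natAbs, ?_⟩
  rw [← zpow_natCast, ← zpow_add₀ hq0, show k + (k.natAbs : ℤ) = 0 by omega]
  simp

lemma qpInf_zpow_succ (hq0 : q ≠ 0) (hq : ‖q‖ < 1) (k : ℤ) :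
    qpInf q (q ^ (k + 1)) = qpInf q q * qExpCoeffInt q k := by
  rcases lt_or_ge k 0 with hk | hk
  · rw [qpInf_eq_zero hq0 (by omega), qExpCoeffInt_of_neg q hk, mul_zero]
  · lift k to ℕ using hk
    rw [qExpCoeffInt_natCast, qExpCoeff, ← qp_mul_qpInf hq q k,
      mul_comm, inv_mul_cancel_left₀ (qp_self_ne_zero hq k), ← pow_succ']
    norm_cast

lemma qExpCoeff_succ_mul (hq : ‖q‖ < 1) (n : ℕ) :
    qExpCoeff q (n + 1) * (1 - q ^ (n + 1)) = qExpCoeff q n := by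
  have h1 := qp_self_ne_zero hq n
  have h2 := one_sub_pow_succ_ne_zero hq n
  rw [qExpCoeff, qExpCoeff, qp_self_succ]
  field_simp

lemma qExpInvCoeff_succ_mul (hq : ‖q‖ < 1) (n : ℕ) :
    qExpInvCoeff q (n + 1) * (1 - q ^ (n + 1)) = -q ^ (n + 1) * qExpInvCoeff q n := by
  have h1 := qp_self_ne_zero hq n
  have h2 := one_sub_pow_succ_ne_zero hq n
  have h3 : (n + 1) * (n + 1 + 1) / 2 = n * (n + 1) / 2 + (n + 1) := by
    rw [show (n + 1) * (n + 1 + 1) = n * (n + 1) + (n + 1) * 2 by ring,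
      Nat.add_mul_div_right _ _ two_pos]
  rw [qExpInvCoeff, qExpInvCoeff, qp_self_succ, h3]
  field_simp
  ring

lemma norm_qExpInvCoeff_le (hq : ‖q‖ < 1) (n : ℕ) : ‖qExpInvCoeff q n‖ ≤ ‖qExpCoeff q n‖ := by
  rw [qExpInvCoeff, qExpCoeff, norm_mul, norm_mul, norm_pow, norm_neg, norm_one, one_pow, one_mul,
    norm_pow]
  exact mul_le_of_le_one_left (norm_nonneg _) (pow_le_one₀ (norm_nonneg _) hq.le)

lemma summable_norm_qExpCoeff (hq : ‖q‖ < 1) {x : ℂ} (hx : ‖x‖ < 1) :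
    Summable fun n : ℕ => ‖x ^ n * qExpCoeff q n‖ := by
  rcases eq_or_ne x 0 with rfl | hx0
  · refine summable_of_ne_finset_zero (s := {0}) fun n hn => ?_
    simp [Finset.mem_singleton.not.mp hn]
  have hne (n : ℕ) : qExpCoeff q n ≠ 0 := inv_ne_zero (qp_self_ne_zero hq n)
  refine summable_of_ratio_test_tendsto_lt_one hx
    (Eventually.of_forall fun n => by simp [hx0, hne]) ?_
  have h1 : Tendsto (fun n : ℕ => q ^ (n + 1)) atTop (𝓝 0) :=
    (tendsto_pow_atTop_nhds_zero_of_norm_lt_one hq).comp (tendsto_add_atTop_nat 1)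
  have h2 : Tendsto (fun n : ℕ => ‖x‖ / ‖1 - q ^ (n + 1)‖) atTop (𝓝 (‖x‖ / ‖(1 : ℂ) - 0‖)) :=
    tendsto_const_nhds.div (tendsto_const_nhds.sub h1).norm (by simp)
  simp only [sub_zero, norm_one, div_one] at h2
  refine h2.congr fun n => ?_
  rw [← qExpCoeff_succ_mul hq n]
  have h3 := one_sub_pow_succ_ne_zero hq n
  have h4 := hne (n + 1)
  simp only [norm_norm, norm_mul, norm_pow, pow_succ]
  have h5 := norm_ne_zero_iff.mpr h3
  have h6 := norm_ne_zero_iff.mpr h4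
  have h7 := norm_ne_zero_iff.mpr hx0
  rw [← pow_succ]
  field_simp

lemma summable_norm_qExpInvCoeff (hq : ‖q‖ < 1) {x : ℂ} (hx : ‖x‖ < 1) :
    Summable fun n : ℕ => ‖x ^ n * qExpInvCoeff q n‖ := by
  refine (summable_norm_qExpCoeff hq hx).of_nonneg_of_le (fun _ => norm_nonneg _) fun n => ?_
  rw [norm_mul, norm_mul]
  exact mul_le_mul_of_nonneg_left (norm_qExpInvCoeff_le hq n) (norm_nonneg _)

lemma summable_norm_qExpCoeffInt (hq : ‖q‖ < 1) {x : ℂ} (hx : ‖x‖ < 1) :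
    Summable fun k : ℤ => ‖x ^ k * qExpCoeffInt q k‖ := by
  rw [← Function.Injective.summable_iff (f := fun k : ℤ => ‖x ^ k * qExpCoeffInt q k‖)
    (Nat.cast_injective (R := ℤ))]
  · simpa [Function.comp_def] using summable_norm_qExpCoeff hq hx
  · intro k hk
    have : k < 0 := by
      by_contra! h
      exact hk ⟨k.toNat, Int.toNat_of_nonneg h⟩
    simp [qExpCoeffInt_of_neg q this]

open PowerSeries in
/-- The coefficients of `(q t;q)_∞ / (q ^ r t;q)_∞` as a power series in `t`. -/
noncomputable def qExpQuot (q : ℂ) (r : ℕ) : PowerSeries ℂ :=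
  rescale (q ^ r) (mk (qExpCoeff q)) * mk (qExpInvCoeff q)

lemma coeff_qExpQuot (q : ℂ) (r s : ℕ) : PowerSeries.coeff s (qExpQuot q r) =
    ∑ p ∈ Finset.HasAntidiagonal.antidiagonal s, (q ^ r) ^ p.1 * qExpCoeff q p.1 * qExpInvCoeff q p.2 := by
  simp [qExpQuot, PowerSeries.coeff_mul, PowerSeries.coeff_rescale]

open PowerSeries in
lemma rescale_mk_qExpCoeff (hq : ‖q‖ < 1) :
    rescale q (mk (qExpCoeff q)) = (1 - X) * mk (qExpCoeff q) := by
  ext n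
  rw [sub_mul, one_mul, map_sub]
  cases n with
  | zero => simp
  | succ n =>
    rw [coeff_succ_X_mul, coeff_rescale, coeff_mk, coeff_mk, ← qExpCoeff_succ_mul hq n]
    ring

open PowerSeries in
lemma mk_qExpInvCoeff (hq : ‖q‖ < 1) :
    mk (qExpInvCoeff q) = (1 - C q * X) * rescale q (mk (qExpInvCoeff q)) := by
  ext n
  rw [sub_mul, one_mul, map_sub, mul_assoc, coeff_C_mul]
  cases n with
  | zero => simp
  | succ n =>
    rw [coeff_succ_X_mul, coeff_rescale, coeff_rescale, coeff_mk, coeff_mk]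
    linear_combination qExpInvCoeff_succ_mul hq n

open PowerSeries in
lemma qExpQuot_succ (hq : ‖q‖ < 1) (r : ℕ) :
    qExpQuot q (r + 1) = (1 - C (q ^ r) * X) * qExpQuot q r := by
  have h : rescale (q ^ (r + 1)) (mk (qExpCoeff q)) =
      (1 - C (q ^ r) * X) * rescale (q ^ r) (mk (qExpCoeff q)) := by
    rw [pow_succ', ← rescale_rescale, rescale_mk_qExpCoeff hq, map_mul, map_sub, map_one, rescale_X]
  rw [qExpQuot, h, mul_assoc, qExpQuot]

open PowerSeries in
lemma qExpQuot_one (hq : ‖q‖ < 1) : qExpQuot q 1 = 1 := by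
  have hres : rescale q (qExpQuot q 1) = qExpQuot q 1 := by
    have h1 : qExpQuot q 1 = rescale q (mk (qExpCoeff q)) * mk (qExpInvCoeff q) := by
      rw [qExpQuot, pow_one]
    conv_rhs => rw [h1, mk_qExpInvCoeff hq]
    rw [h1, map_mul]
    conv_lhs => rw [rescale_mk_qExpCoeff hq, map_mul, map_sub, map_one, rescale_X]
    ring
  ext n
  cases n with
  | zero => simp [coeff_qExpQuot, qExpCoeff, qExpInvCoeff, qp]
  | succ n =>
    have h := congrArg (coeff (n + 1)) hres
    rw [coeff_rescale] at h
    have h2 : (1 - q ^ (n + 1)) * coeff (n + 1) (qExpQuot q 1) = 0 := by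
      linear_combination -h
    rw [(mul_eq_zero.mp h2).resolve_left (one_sub_pow_succ_ne_zero hq n)]
    simp [coeff_one]

open PowerSeries in
lemma coeff_qExpQuot_zero (hq : ‖q‖ < 1) (s : ℕ) : coeff s (qExpQuot q 0) = 1 := by
  have h1 := qExpQuot_succ hq 0
  rw [zero_add, qExpQuot_one hq, pow_zero, map_one, one_mul] at h1
  have h2 : qExpQuot q 0 = PowerSeries.mk 1 := by
    rw [← mul_one (PowerSeries.mk 1), h1, ← mul_assoc, mk_one_mul_one_sub_eq_one, one_mul]
  simp [h2]

open PowerSeries in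
lemma coeff_qExpQuot_eq_zero (hq : ‖q‖ < 1) {r s : ℕ} (hr : r ≠ 0) (hs : r ≤ s) :
    coeff s (qExpQuot q r) = 0 := by
  induction r, Nat.one_le_iff_ne_zero.mpr hr using Nat.le_induction generalizing s with
  | base => rw [qExpQuot_one hq, coeff_one, if_neg (by omega)]
  | succ r hr1 ih =>
    obtain ⟨s, rfl⟩ : ∃ t, s = t + 1 := ⟨s - 1, by omega⟩
    rw [qExpQuot_succ hq, sub_mul, one_mul, map_sub, mul_assoc, coeff_C_mul, coeff_succ_X_mul,
      ih (by omega) (by omega), ih (by omega) (by omega), mul_zero, sub_zero]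

end QPochhammer

section QBessel

lemma hasSum_mul_prod_of_summable_norm {f g : ℕ → ℂ} (hf : Summable fun n => ‖f n‖)
    (hg : Summable fun n => ‖g n‖) : HasSum (fun p : ℕ × ℕ => f p.1 * g p.2)
      (∑' n, ∑ p ∈ Finset.HasAntidiagonal.antidiagonal n, f p.1 * g p.2) := by
  rw [← tsum_mul_tsum_eq_tsum_sum_antidiagonal_of_summable_norm hf hg]
  exact hf.of_norm.hasSum.mul hg.of_norm.hasSum (summable_mul_of_summable_norm hf hg)

variable {q : ℝ}

lemma hasSum_qBesselJ (hq0 : (q : ℂ) ≠ 0) (hq : ‖(q : ℂ)‖ < 1) {x : ℂ} (hx0 : x ≠ 0)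
    (hx : ‖x‖ < 1) (k : ℤ) :
    HasSum (fun b : ℕ => x ^ (k + b) * qExpCoeffInt q (k + b) * (x ^ b * qExpInvCoeff q b))
      (qBesselJ q k x) := by
  have hJ : qBesselJ q k x =
      ∑' b : ℕ, x ^ (k + b) * qExpCoeffInt q (k + b) * (x ^ b * qExpInvCoeff q b) := by
    rw [qBesselJ, phiT, ← tsum_mul_left]
    refine tsum_congr fun b => ?_
    have h1 : (q : ℂ) ^ (k + 1) * (q : ℂ) ^ b = (q : ℂ) ^ (k + b + 1) := by
      rw [← zpow_natCast, ← zpow_add₀ hq0]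
      congr 1
      ring
    have h2 : b * (b + 1) / 2 = b * (b - 1) / 2 + b := by
      simpa [mul_comm] using Nat.triangle_succ b
    have h3 := qpInf_self_ne_zero hq
    rw [h1, qpInf_zpow_succ hq0 hq, qExpInvCoeff, h2, zpow_add₀ hx0, zpow_natCast]
    field_simp
    ring
  rw [hJ]
  refine Summable.hasSum (Summable.of_norm ?_)
  have hE := summable_norm_qExpInvCoeff hq hx
  have he := (summable_norm_qExpCoeffInt hq hx).tendsto_cofinite_zero.bddAbove_range_of_cofinite
  obtain ⟨C, hC⟩ := he
  refine (hE.mul_left C).of_nonneg_of_le (fun _ => norm_nonneg _) fun b => ?_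
  rw [norm_mul]
  exact mul_le_mul_of_nonneg_right (hC ⟨k + b, rfl⟩) (norm_nonneg _)

lemma hasSum_qExpCoeffInt_mul_qExpInvCoeff (q y : ℂ) (r s : ℕ) :
    HasSum (fun d : ℕ => (q ^ r * y) ^ ((s : ℤ) - d) * qExpCoeffInt q (s - d) *
        (y ^ d * qExpInvCoeff q d))
      (y ^ s * PowerSeries.coeff s (qExpQuot q r)) := by
  have hsum : y ^ s * PowerSeries.coeff s (qExpQuot q r) =
      ∑ d ∈ Finset.range (s + 1), (q ^ r * y) ^ ((s : ℤ) - d) * qExpCoeffInt q (s - d) *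
        (y ^ d * qExpInvCoeff q d) := by
    rw [coeff_qExpQuot, ← Finset.Nat.sum_antidiagonal_swap,
      Finset.Nat.sum_antidiagonal_eq_sum_range_succ_mk, Finset.mul_sum]
    refine Finset.sum_congr rfl fun d hd => ?_
    obtain ⟨a, rfl⟩ := Nat.exists_eq_add_of_le (Finset.mem_range_succ_iff.mp hd)
    rw [show ((d + a : ℕ) : ℤ) - d = (a : ℕ) by push_cast; ring, qExpCoeffInt_natCast,
      zpow_natCast]
    simp only [Prod.swap_prod_mk, Nat.add_sub_cancel_left]
    ring
  rw [hsum]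
  refine hasSum_sum_of_ne_finset_zero fun d hd => ?_
  rw [qExpCoeffInt_of_neg q (by rw [Finset.mem_range] at hd; omega), mul_zero, zero_mul]

lemma hasSum_qExpCoeff_mul_qExpInvCoeff {q : ℂ} (hq : ‖q‖ < 1) {z : ℂ} (hz : ‖z‖ < 1) :
    HasSum (fun p : ℕ × ℕ => z ^ p.1 * qExpCoeff q p.1 * (z ^ p.2 * qExpInvCoeff q p.2))
      (1 - z)⁻¹ := by
  have hf := summable_norm_qExpCoeff hq hz
  have hg := summable_norm_qExpInvCoeff hq hz
  convert hasSum_mul_prod_of_summable_norm hf hg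
  rw [← tsum_geometric_of_norm_lt_one hz]
  refine tsum_congr fun s => ?_
  rw [← mul_one (z ^ s), ← coeff_qExpQuot_zero hq s, coeff_qExpQuot, Finset.mul_sum]
  refine Finset.sum_congr rfl fun p hp => ?_
  rw [← Finset.HasAntidiagonal.mem_antidiagonal.mp hp]
  ring

/-- The change of summation indices `((k, b), d) ↦ (k - d, (b, d))`. -/
def subIndexEquiv : (ℤ × ℕ) × ℕ ≃ ℤ × (ℕ × ℕ) where
  toFun p := (p.1.1 - p.2, (p.1.2, p.2))
  invFun p := ((p.1 + p.2.2, p.2.1), p.2.2)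
  left_inv p := by simp
  right_inv p := by simp

lemma hasSum_qBesselJ_mul_qBesselJ (hq0 : (q : ℂ) ≠ 0) (hq : ‖(q : ℂ)‖ < 1) {y : ℂ} (hy0 : y ≠ 0)
    (hy : ‖y‖ < 1) (r : ℕ) :
    HasSum (fun j : ℤ => qBesselJ q (j + r) ((q : ℂ) ^ r * y) * qBesselJ q j y)
      (if r = 0 then (1 - y ^ 2)⁻¹ else 0) := by
  set x : ℂ := (q : ℂ) ^ r * y with hx_def
  have hx0 : x ≠ 0 := mul_ne_zero (pow_ne_zero _ hq0) hy0
  have hx : ‖x‖ < 1 := by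
    rw [hx_def, norm_mul, norm_pow]
    exact (mul_le_of_le_one_left (norm_nonneg _) (pow_le_one₀ (norm_nonneg _) hq.le)).trans_lt hy
  let u : ℤ → ℂ := fun k => x ^ k * qExpCoeffInt q k
  let v : ℕ → ℂ := fun b => x ^ b * qExpInvCoeff q b
  let w : ℤ → ℂ := fun k => y ^ k * qExpCoeffInt q k
  let z : ℕ → ℂ := fun d => y ^ d * qExpInvCoeff q d
  have hu : Summable fun k => ‖u k‖ := summable_norm_qExpCoeffInt hq hx
  have hv : Summable fun b => ‖v b‖ := summable_norm_qExpInvCoeff hq hx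
  have hw : Summable fun k => ‖w k‖ := summable_norm_qExpCoeffInt hq hy
  have hz : Summable fun d => ‖z d‖ := summable_norm_qExpInvCoeff hq hy
  let F : ℤ × (ℕ × ℕ) → ℂ := fun p =>
    (u (p.1 + r + p.2.1) * v p.2.1) * (w (p.1 + p.2.2) * z p.2.2)
  have hFe (k : ℤ) (b d : ℕ) :
      F (subIndexEquiv ((k, b), d)) = w k * v b * (u (k + r + b - d) * z d) := by
    simp only [F, subIndexEquiv, Equiv.coe_fn_mk, sub_add_cancel]
    rw [show k - (d : ℤ) + r + b = k + r + b - d by ring]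
    ring
  have hFesum : Summable (F ∘ subIndexEquiv) := by
    obtain ⟨C, hC⟩ := hu.tendsto_cofinite_zero.bddAbove_range_of_cofinite
    refine Summable.of_norm_bounded (((hw.mul_norm hv).mul_norm hz).mul_left C) ?_
    rintro ⟨⟨k, b⟩, d⟩
    simp only [Function.comp_apply, hFe, norm_mul]
    have := mul_le_mul_of_nonneg_right (hC ⟨k + r + b - d, rfl⟩)
      (mul_nonneg (mul_nonneg (norm_nonneg (w k)) (norm_nonneg (v b))) (norm_nonneg (z d)))
    linarith
  have hFsum : Summable F := subIndexEquiv.summable_iff.mp hFesum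
  have hJ : HasSum (fun j : ℤ => qBesselJ q (j + r) x * qBesselJ q j y) (∑' p, F p) := by
    refine hFsum.hasSum.prod_fiberwise fun j => ?_
    have h1 : HasSum (fun b : ℕ => u (j + r + b) * v b) (qBesselJ q (j + r) x) :=
      hasSum_qBesselJ hq0 hq hx0 hx (j + r)
    have h2 : HasSum (fun d : ℕ => w (j + d) * z d) (qBesselJ q j y) :=
      hasSum_qBesselJ hq0 hq hy0 hy j
    have h3 : Summable fun p : ℕ × ℕ => (u (j + r + p.1) * v p.1) * (w (j + p.2) * z p.2) :=
      hFsum.prod_factor j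
    have h4 := h1.mul h2 h3
    exact h4
  have hH : HasSum (fun p : ℤ × ℕ => w p.1 * v p.2 *
      (y ^ (p.1 + r + p.2).toNat * PowerSeries.coeff (p.1 + r + p.2).toNat (qExpQuot q r)))
      (∑' p, F p) := by
    refine (subIndexEquiv.hasSum_iff.mpr hFsum.hasSum).prod_fiberwise ?_
    rintro ⟨k, b⟩
    simp only [Function.comp_apply, hFe]
    rcases lt_or_ge k 0 with hk | hk
    · have : w k = 0 := by simp [w, qExpCoeffInt_of_neg _ hk]
      simp [this, hasSum_zero]
    · lift k to ℕ using hk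
      have := hasSum_qExpCoeffInt_mul_qExpInvCoeff q y r (k + r + b)
      push_cast at this
      exact this.mul_left _
  convert hJ using 1
  refine HasSum.unique ?_ hH
  split_ifs with hr
  · subst hr
    have hinj : Function.Injective (Prod.map ((↑) : ℕ → ℤ) (id : ℕ → ℕ)) :=
      Nat.cast_injective.prodMap Function.injective_id
    rw [← hinj.hasSum_iff]
    · have hy2 : ‖y ^ 2‖ < 1 := by
        rw [norm_pow]
        exact pow_lt_one₀ (norm_nonneg _) hy two_ne_zero
      convert hasSum_qExpCoeff_mul_qExpInvCoeff hq hy2 using 2 with p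
      have hp : ((p.1 : ℤ) + (0 : ℕ) + p.2).toNat = p.1 + p.2 := by omega
      simp only [Function.comp_apply, Prod.map_fst, Prod.map_snd, id_eq, hp, coeff_qExpQuot_zero hq, w, v,
        zpow_natCast, qExpCoeffInt_natCast, hx_def, pow_zero, one_mul, mul_one]
      ring
    · rintro ⟨k, b⟩ hkb
      have hk : k < 0 := by
        by_contra! h
        exact hkb ⟨(k.toNat, b), by simp [Int.toNat_of_nonneg h]⟩
      simp [w, qExpCoeffInt_of_neg _ hk]
  · convert hasSum_zero with p
    obtain ⟨k, b⟩ := p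
    rcases lt_or_ge k 0 with hk | hk
    · simp [w, qExpCoeffInt_of_neg _ hk]
    · rw [coeff_qExpQuot_eq_zero hq hr (by omega), mul_zero, mul_zero]

lemma hasSum_qBesselJ_mul_qBesselJ_of_le (hq0 : (q : ℂ) ≠ 0) (hq : ‖(q : ℂ)‖ < 1) {a : ℂ}
    (ha : a ≠ 0) {m n : ℤ} (hnm : n ≤ m) (hn : ‖a * (q : ℂ) ^ n‖ < 1) :
    HasSum (fun j : ℤ =>
        qBesselJ q (j + m) (a * (q : ℂ) ^ m) * qBesselJ q (j + n) (a * (q : ℂ) ^ n))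
      (if m = n then (1 - (a * (q : ℂ) ^ n) ^ 2)⁻¹ else 0) := by
  obtain ⟨r, rfl⟩ := Int.le.dest hnm
  have h := hasSum_qBesselJ_mul_qBesselJ hq0 hq (mul_ne_zero ha (zpow_ne_zero n hq0)) hn r
  rw [← (Equiv.addRight n).hasSum_iff] at h
  convert h using 1
  · ext j
    simp only [Function.comp_apply, Equiv.coe_addRight]
    rw [show j + (n + r) = j + n + r by ring, zpow_add₀ hq0, zpow_natCast]
    congr 2
    ring
  · simp

end QBessel

theorem stmt_19 (q : ℝ) (hq0 : 0 < q) (hq1 : q < 1) (α : ℝ) (hα : α ≠ 0) (m n : ℤ)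
    (hm : q ^ m < |α|) (hn : q ^ n < |α|) :
    HasSum (fun j : ℤ =>
        qBesselJ q (j + m) ((α : ℂ)⁻¹ * (q : ℂ) ^ m) *
          qBesselJ q (j + n) ((α : ℂ)⁻¹ * (q : ℂ) ^ n))
      ((if m = n then 1 else 0) / (1 - (α : ℂ) ^ (-2 : ℤ) * (q : ℂ) ^ (2 * m))) := by
  have hq0' : (q : ℂ) ≠ 0 := by exact_mod_cast hq0.ne'
  have hq : ‖(q : ℂ)‖ < 1 := by rwa [norm_real, Real.norm_of_nonneg hq0.le]
  have ha : (α : ℂ)⁻¹ ≠ 0 := by simpa using hα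
  have hlt {k : ℤ} (hk : q ^ k < |α|) : ‖(α : ℂ)⁻¹ * (q : ℂ) ^ k‖ < 1 := by
    rw [norm_mul, norm_inv, norm_zpow, norm_real, norm_real, Real.norm_of_nonneg hq0.le,
      Real.norm_eq_abs, inv_mul_lt_iff₀ (abs_pos.mpr hα), mul_one]
    exact hk
  have hval : (if m = n then 1 else 0) / (1 - (α : ℂ) ^ (-2 : ℤ) * (q : ℂ) ^ (2 * m)) =
      if m = n then (1 - ((α : ℂ)⁻¹ * (q : ℂ) ^ m) ^ 2)⁻¹ else 0 := by
    have hsq : ((α : ℂ)⁻¹ * (q : ℂ) ^ m) ^ 2 = (α : ℂ) ^ (-2 : ℤ) * (q : ℂ) ^ (2 * m) := by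
      rw [mul_pow, mul_comm 2 m, zpow_mul, zpow_neg, inv_pow]
      norm_cast
    rw [hsq]
    split_ifs <;> simp
  rw [hval]
  rcases le_total n m with h | h
  · convert hasSum_qBesselJ_mul_qBesselJ_of_le hq0' hq ha h (hlt hn) using 1
    split_ifs with hmn
    · rw [hmn]
    · rfl
  · convert hasSum_qBesselJ_mul_qBesselJ_of_le hq0' hq ha h (hlt hm) using 1
    · simp only [mul_comm]
    · simp only [eq_comm]
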